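/- Let p be an odd prime, q = p^r with q ≡ 1 (mod 4), and s = v₂(q−1). Let k be a field of characteristic ≠ 2 and let ε be a primitive 2^s-th root of unity in a fixed algebraic closure of k. Let P be any Sylow 2-subgroup of SL₂(F_q). Then the minimal faithful representation dimension of P over k equals: 2·[k(ε):k] if there is no k-algebra automorphism of k(ε) sending ε to ε⁻¹; [k(ε):k] if such an automorphism exists and the equation x² + y² = −1 has a solution with x, y ∈ k(ε+ε⁻¹); and 2·[k(ε):k] if such an automorphism exists and x² + y² = −1 has no solution in k(ε+ε⁻¹). -/

import Mathlib

open IntermediateField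

/-- The minimal faithful representation dimension of a group `G` over a field `k`:
the least `d` such that there is an injective group homomorphism `G →* GL d k`. -/
noncomputable def minFaithfulDim (k : Type*) [Field k] (G : Type*) [Group G] : ℕ :=
  sInf {d : ℕ | ∃ φ : G →* Matrix.GeneralLinearGroup (Fin d) k, Function.Injective φ}

namespace QuaternionGroup

variable {G : Type*} [Group G]

/-- The homomorphism from a generalised quaternion group determined by two elements satisfying
its defining relations. -/
noncomputable def lift {n : ℕ} (x y : G) (hx : x ^ (2 * n) = 1) (hy : y * y = x ^ n)
    (hxy : y * x * y⁻¹ = x⁻¹) : QuaternionGroup n →* G :=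
  let f : ZMod (2 * n) →+ Additive G := ZMod.lift (2 * n)
    ⟨(zmultiplesHom (Additive G)) (Additive.ofMul x), by
      simpa [← ofMul_pow, ← ofMul_zpow] using mod_cast congrArg Additive.ofMul hx⟩
  have hf : ∀ j : ℤ, (f (j : ZMod (2 * n))).toMul = x ^ j := fun j => by
    simp only [f, ZMod.lift_coe]; rfl
  have hc : ∀ j : ℤ, x ^ j * y = y * x ^ (-j) := fun j => by
    have h : y * x ^ (-j) * y⁻¹ = x ^ j := by
      rw [← conj_zpow, hxy, inv_zpow, zpow_neg, inv_inv]
    rw [← h]; group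
  MonoidHom.mk' (fun g => match g with
    | a i => (f i).toMul
    | xa i => y * (f i).toMul) <| by
    rintro (i | i) (j | j) <;> obtain ⟨i, rfl⟩ := ZMod.intCast_surjective i <;>
      obtain ⟨j, rfl⟩ := ZMod.intCast_surjective j
    · simp only [a_mul_a, ← Int.cast_add, hf, zpow_add]
    · simp only [a_mul_xa, ← Int.cast_sub, hf]
      rw [← mul_assoc, hc, mul_assoc, ← zpow_add, neg_add_eq_sub]
    · simp only [xa_mul_a, ← Int.cast_add, hf, zpow_add, mul_assoc]
    · have e : ((n : ZMod (2 * n)) + (j : ZMod (2 * n)) - (i : ZMod (2 * n)))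
        = (((n : ℤ) + j - i : ℤ) : ZMod (2 * n)) := by push_cast; rfl
      simp only [xa_mul_xa, e, hf]
      rw [mul_assoc, ← mul_assoc (x ^ i), hc, mul_assoc, ← mul_assoc, hy, ← zpow_add,
        ← zpow_natCast, ← zpow_add]
      congr 1; ring

theorem lift_a {n : ℕ} (x y : G) (hx : x ^ (2 * n) = 1) (hy : y * y = x ^ n)
    (hxy : y * x * y⁻¹ = x⁻¹) (j : ℤ) :
    lift x y hx hy hxy (a (j : ZMod (2 * n))) = x ^ j := by
  change Additive.toMul (ZMod.lift (A := Additive G) (2 * n) _ (j : ZMod (2 * n))) = x ^ j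
  rw [ZMod.lift_coe]; rfl

/-- A homomorphism from a generalised quaternion `2`-group is injective as soon as it does not
kill the central involution. -/
theorem injective_of_map_ne_one {t : ℕ} (φ : QuaternionGroup (2 ^ t) →* G)
    (h : φ (a 1) ^ 2 ^ t ≠ 1) : Function.Injective φ := by
  have : Fact (Nat.Prime 2) := ⟨Nat.prime_two⟩
  have h1 : φ (a 1) ^ 2 ^ (t + 1) = 1 := by
    rw [pow_succ', ← map_pow, a_one_pow_n, map_one]
  have ho : orderOf (φ (a 1)) = 2 ^ (t + 1) := orderOf_eq_prime_pow h h1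
  rw [injective_iff_map_eq_one]
  rintro (i | i) hi
  · rw [← ZMod.natCast_zmod_val i, ← a_one_pow, map_pow] at hi
    have := orderOf_dvd_of_pow_eq_one hi
    rw [ho, pow_succ'] at this
    rw [← ZMod.natCast_zmod_val i, (ZMod.natCast_eq_zero_iff _ _).2 this, a_zero]
  · exact absurd (by rw [← map_pow, a_one_pow, ← xa_sq i, map_pow, hi, one_pow]) h

end QuaternionGroup

theorem Matrix.card_SL_two (F : Type*) [Field F] [Fintype F] :
    Nat.card (Matrix.SpecialLinearGroup (Fin 2) F) =
      Fintype.card F * (Fintype.card F - 1) * (Fintype.card F + 1) := by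
  classical
  set q := Fintype.card F with hq
  have hq1 : 1 < q := Fintype.one_lt_card
  let d : GL (Fin 2) F →* Fˣ := Matrix.GeneralLinearGroup.det
  have hsurj : Function.Surjective d := fun u => by
    refine ⟨Matrix.GeneralLinearGroup.mkOfDetNeZero !![(u : F), 0; 0, 1] (by simp), ?_⟩
    ext; simp [d, Matrix.GeneralLinearGroup.mkOfDetNeZero]
  have e : Matrix.SpecialLinearGroup (Fin 2) F ≃ d.ker :=
    { toFun := fun A => ⟨Matrix.SpecialLinearGroup.toGL A, by
        rw [MonoidHom.mem_ker]; ext; simp [d]⟩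
      invFun := fun A => ⟨A.1.1, by
        have := congrArg Units.val ((MonoidHom.mem_ker).1 A.2)
        simpa [d] using this⟩
      left_inv := fun A => by ext; simp
      right_inv := fun A => by ext; rfl }
  have h1 := Subgroup.card_eq_card_quotient_mul_card_subgroup d.ker
  rw [← Nat.card_congr e, Nat.card_congr (QuotientGroup.quotientKerEquivOfSurjective d hsurj).toEquiv,
    Matrix.card_GL_field, Nat.card_eq_fintype_card, Fintype.card_units, ← hq] at h1
  simp only [Fin.prod_univ_two, Fin.val_zero, Fin.val_one, pow_zero, pow_one] at h1
  obtain ⟨m, hm⟩ : ∃ m, q = m + 1 := ⟨q - 1, by omega⟩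
  rw [hm] at h1 ⊢
  have e1 : (m + 1) ^ 2 - 1 = m * (m + 2) := by
    rw [Nat.sub_eq_iff_eq_add (Nat.one_le_pow _ _ (by omega))]; ring
  have e2 : (m + 1) ^ 2 - (m + 1) = m * (m + 1) := by
    rw [Nat.sub_eq_iff_eq_add (by nlinarith)]; ring
  rw [e1, e2] at h1
  have hm0 : 0 < m := by omega
  simp only [Nat.add_sub_cancel] at h1 ⊢
  apply Nat.eq_of_mul_eq_mul_left hm0
  rw [← h1]; ring

/-- If `q ≡ 1 (mod 4)`, the Sylow `2`-subgroups of `SL₂(F_q)` are generalised quaternion. -/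
theorem nonempty_mulEquiv_quaternionGroup {F : Type*} [Field F] [Fintype F] {t : ℕ} (ht : 1 ≤ t)
    (hs : padicValNat 2 (Fintype.card F - 1) = t + 1)
    (P : Sylow 2 (Matrix.SpecialLinearGroup (Fin 2) F)) :
    Nonempty (QuaternionGroup (2 ^ t) ≃* ↥P) := by
  classical
  have : Fact (Nat.Prime 2) := ⟨Nat.prime_two⟩
  have hq1 : 1 < Fintype.card F := Fintype.one_lt_card
  have hdvd : 2 ^ (t + 1) ∣ Fintype.card F - 1 := hs ▸ pow_padicValNat_dvd
  have h4 : 4 ∣ Fintype.card F - 1 :=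
    (pow_dvd_pow 2 (show 2 ≤ t + 1 by omega)).trans hdvd
  obtain ⟨u, hu⟩ : ∃ u : Fˣ, orderOf u = 2 ^ (t + 1) := by
    obtain ⟨g, hg⟩ := IsCyclic.exists_ofOrder_eq_natCard (α := Fˣ)
    rw [Nat.card_eq_fintype_card, Fintype.card_units] at hg
    obtain ⟨m, hm⟩ := hdvd
    refine ⟨g ^ m, ?_⟩
    have hm0 : 0 < m := Nat.pos_of_ne_zero (by rintro rfl; omega)
    rw [orderOf_pow_of_dvd hm0.ne' (by rw [hg, hm]; exact dvd_mul_left _ _), hg, hm,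
      Nat.mul_div_cancel _ hm0]
  have hu2 : u ^ 2 ^ t ≠ 1 := fun h => by
    have := orderOf_dvd_of_pow_eq_one h
    rw [hu] at this
    exact absurd (Nat.le_of_dvd (by positivity) this)
      (by rw [not_le]; exact Nat.pow_lt_pow_right (by omega) (by omega))
  have hu1 : u ^ 2 ^ t = -1 := by
    have h1 : (u ^ 2 ^ t) ^ 2 = 1 := by rw [← pow_mul, ← pow_succ, ← hu, pow_orderOf_eq_one]
    have h3 : ((u ^ 2 ^ t : Fˣ) : F) ^ 2 = 1 := by rw [← Units.val_pow_eq_pow_val, h1, Units.val_one]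
    rcases sq_eq_one_iff.1 h3 with h | h
    · exact absurd (Units.ext h) hu2
    · exact Units.ext h
  let x : Matrix.SpecialLinearGroup (Fin 2) F := ⟨!![(u : F), 0; 0, (↑u⁻¹ : F)], by simp⟩
  let y : Matrix.SpecialLinearGroup (Fin 2) F := ⟨!![0, 1; -1, 0], by simp⟩
  have hxp : ∀ m : ℕ, (x ^ m : Matrix.SpecialLinearGroup (Fin 2) F).1 =
      !![((u ^ m : Fˣ) : F), 0; 0, (↑(u ^ m)⁻¹ : F)] := fun m => by
    induction m with
    | zero => ext i j; fin_cases i <;> fin_cases j <;> simp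
    | succ m ih =>
      rw [pow_succ, Matrix.SpecialLinearGroup.coe_mul, ih]
      ext i j; fin_cases i <;> fin_cases j <;> simp [x, pow_succ, mul_comm]
  have hy : y * y = x ^ 2 ^ t := by
    ext i j
    rw [Matrix.SpecialLinearGroup.coe_mul, hxp, hu1]
    fin_cases i <;> fin_cases j <;> simp [y]
  have hx : x ^ (2 * 2 ^ t) = 1 := by
    ext i j
    rw [hxp, ← pow_succ', ← hu, pow_orderOf_eq_one]
    fin_cases i <;> fin_cases j <;> simp
  have hxy : y * x * y⁻¹ = x⁻¹ := by
    rw [mul_inv_eq_iff_eq_mul, eq_inv_mul_iff_mul_eq]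
    ext i j
    rw [Matrix.SpecialLinearGroup.coe_mul, Matrix.SpecialLinearGroup.coe_mul]
    fin_cases i <;> fin_cases j <;> simp [x, y]
  let φ := QuaternionGroup.lift x y hx hy hxy
  have hφ1 : φ (QuaternionGroup.a 1) = x := by
    have := QuaternionGroup.lift_a x y hx hy hxy 1
    simpa using this
  have hφ : Function.Injective φ := QuaternionGroup.injective_of_map_ne_one φ <| by
    rw [hφ1]
    intro h
    have := congrArg (fun A => A.1 0 0) h
    simp only [hxp] at this
    exact hu2 (Units.ext (by simpa using this))
  have hcard : Nat.card φ.range = 2 ^ (Nat.card (Matrix.SpecialLinearGroup (Fin 2) F)).factorization 2 := by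
    rw [Nat.card_congr (MonoidHom.ofInjective hφ).symm.toEquiv, Nat.card_eq_fintype_card,
      QuaternionGroup.card, Matrix.card_SL_two, Nat.factorization_mul (by simp; omega) (by omega),
      Nat.factorization_mul (by omega) (by omega)]
    simp only [Finsupp.add_apply, Nat.factorization_def _ Nat.prime_two, hs]
    have e1 : padicValNat 2 (Fintype.card F) = 0 := padicValNat.eq_zero_of_not_dvd (by omega)
    have e2 : padicValNat 2 (Fintype.card F + 1) = 1 := by
      obtain ⟨m, hm⟩ : ∃ m, Fintype.card F + 1 = 2 * (2 * m + 1) := ⟨(Fintype.card F - 1) / 4, by omega⟩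
      rw [hm, padicValNat.mul (by omega) (by omega), padicValNat_self,
        padicValNat.eq_zero_of_not_dvd (by omega)]
    rw [e1, e2]; ring
  exact ⟨(MonoidHom.ofInjective hφ).trans ((Sylow.ofCard φ.range hcard).equiv P)⟩

theorem minFaithfulDim_congr (k : Type*) [Field k] {G H : Type*} [Group G] [Group H] (e : G ≃* H) :
    minFaithfulDim k G = minFaithfulDim k H := by
  unfold minFaithfulDim
  congr 1
  ext d
  exact ⟨fun ⟨φ, h⟩ => ⟨φ.comp e.symm.toMonoidHom, h.comp e.symm.injective⟩,
    fun ⟨φ, h⟩ => ⟨φ.comp e.toMonoidHom, h.comp e.injective⟩⟩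

section

open Polynomial Module

variable {k : Type*} [Field k] {V : Type*} [AddCommGroup V] [Module k V]

theorem exists_faithful_finrank [FiniteDimensional k V] {G : Type*} [Group G]
    (φ : G →* (End k V)ˣ) (h : Function.Injective φ) :
    ∃ ψ : G →* Matrix.GeneralLinearGroup (Fin (finrank k V)) k, Function.Injective ψ :=
  let e := Matrix.GeneralLinearGroup.toLin' (finBasis k V)
  ⟨e.symm.toMonoidHom.comp φ, e.symm.injective.comp h⟩

theorem QuaternionGroup.exists_faithful_of_end [FiniteDimensional k V] {t : ℕ} {A A' B : End k V}
    (hA : A * A' = 1) (hA' : A' * A = 1) (hAt : A ^ 2 ^ t = -1) (hB : B * B = -1)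
    (hBA : B * A = A' * B) (hV : (-1 : End k V) ≠ 1) :
    ∃ ψ : QuaternionGroup (2 ^ t) →* Matrix.GeneralLinearGroup (Fin (finrank k V)) k,
      Function.Injective ψ := by
  let x : (End k V)ˣ := ⟨A, A', hA, hA'⟩
  let y : (End k V)ˣ := ⟨B, -B, by rw [mul_neg, hB, neg_neg], by rw [neg_mul, hB, neg_neg]⟩
  have hxt : x ^ 2 ^ t = -1 := Units.ext (by simpa [x] using hAt)
  have hx : x ^ (2 * 2 ^ t) = 1 := by rw [mul_comm, pow_mul, hxt, neg_one_sq]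
  have hy : y * y = x ^ 2 ^ t := by rw [hxt]; exact Units.ext hB
  have hxy : y * x * y⁻¹ = x⁻¹ := by rw [mul_inv_eq_iff_eq_mul]; exact Units.ext hBA
  refine exists_faithful_finrank (lift x y hx hy hxy) (injective_of_map_ne_one _ ?_)
  have : lift x y hx hy hxy (a 1) = x := by simpa using lift_a x y hx hy hxy 1
  rw [this, hxt]
  exact fun h => hV (congrArg Units.val h)

theorem exists_irreducible_aeval_apply_eq_zero (T : End k V) {p : k[X]} (hp : p ≠ 0) {v : V}
    (hv : v ≠ 0) (hpv : aeval T p v = 0) :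
    ∃ g, Irreducible g ∧ g ∣ p ∧ ∃ w, w ≠ 0 ∧ aeval T g w = 0 := by
  induction p using WfDvdMonoid.induction_on_irreducible with
  | zero => exact absurd rfl hp
  | unit u hu =>
    obtain ⟨q, hq⟩ := hu.exists_left_inv
    refine absurd ?_ hv
    have : aeval T (q * u) v = 0 := by rw [map_mul, End.mul_apply, hpv, map_zero]
    rwa [hq, map_one, End.one_apply] at this
  | mul a i ha hi ih =>
    by_cases h : aeval T a v = 0
    · obtain ⟨g, hg, hga, hw⟩ := ih ha h
      exact ⟨g, hg, hga.mul_left i, hw⟩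
    · exact ⟨i, hi, dvd_mul_right i a, _, h, by rwa [← End.mul_apply, ← map_mul]⟩

/-- In a faithful representation of a generalised quaternion `2`-group, some generator of the
cyclic maximal subgroup acts on a nonzero vector as a prescribed primitive root of unity. -/
theorem QuaternionGroup.exists_units_of_faithful {t : ℕ} {ε : AlgebraicClosure k}
    (h2 : (2 : k) ≠ 0) (hε : IsPrimitiveRoot ε (2 ^ (t + 1)))
    {ψ : QuaternionGroup (2 ^ t) →* (End k V)ˣ} (hψ : Function.Injective ψ) :
    ∃ (x y : (End k V)ˣ) (w : V), y * x * y⁻¹ = x⁻¹ ∧ w ≠ 0 ∧ y.1 (y.1 w) = -w ∧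
      aeval x.1 (minpoly k ε) w = 0 := by
  have : Fact (Nat.Prime 2) := ⟨Nat.prime_two⟩
  set A := ψ (a 1) with hA
  set B := ψ (xa 0) with hB
  have hBB : B * B = A ^ 2 ^ t := by
    rw [hA, hB, ← map_pow, a_one_pow, ← map_mul, xa_mul_xa, add_zero, sub_zero]
  have hBA : B * A * B⁻¹ = A⁻¹ := by
    rw [mul_inv_eq_iff_eq_mul, eq_inv_mul_iff_mul_eq, hA, hB, ← map_mul, ← map_mul, xa_mul_a,
      a_mul_xa, zero_add, sub_self]
  have hA2 : A ^ 2 ^ t * A ^ 2 ^ t = 1 := by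
    rw [← pow_add, ← two_mul, hA, ← map_pow, a_one_pow_n, map_one]
  have hA1 : A ^ 2 ^ t ≠ 1 := by
    rw [hA, ← map_pow, ← map_one ψ]
    intro h
    have h1 := orderOf_dvd_of_pow_eq_one (hψ h)
    rw [orderOf_a_one] at h1
    have := Nat.le_of_dvd (by positivity) h1
    have : 0 < 2 ^ t := by positivity
    omega
  obtain ⟨u, hu⟩ : ∃ u, (A.1 ^ 2 ^ t) u ≠ u := by
    by_contra! h
    exact hA1 (Units.ext (LinearMap.ext (by simpa using h)))
  have hA2' : ∀ u, (A.1 ^ 2 ^ t) ((A.1 ^ 2 ^ t) u) = u := fun u => by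
    rw [← End.mul_apply, ← Units.val_pow_eq_pow_val, ← Units.val_mul, hA2]; rfl
  obtain ⟨g, hg, hgp, w, hw, hgw⟩ := exists_irreducible_aeval_apply_eq_zero A.1
    (p := X ^ 2 ^ t + C 1) (X_pow_add_C_ne_zero (by positivity) 1)
    (v := u - (A.1 ^ 2 ^ t) u) (sub_ne_zero.2 hu.symm) (by simp [hA2'])
  obtain ⟨η, hη⟩ := IsAlgClosed.exists_aeval_eq_zero (AlgebraicClosure k) g
    (degree_pos_of_irreducible hg).ne'
  have hη1 : η ^ 2 ^ t = -1 := by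
    have := aeval_eq_zero_of_dvd_aeval_eq_zero hgp hη
    rw [eq_neg_iff_add_eq_zero]
    simpa using this
  have h2' : (2 : AlgebraicClosure k) ≠ 0 := by
    have := (map_ne_zero (algebraMap k (AlgebraicClosure k))).2 h2
    rwa [map_ofNat] at this
  have hη2 : IsPrimitiveRoot η (2 ^ (t + 1)) := by
    rw [← orderOf_eq_prime_pow (x := η) (p := 2) (n := t) ?_ ?_]
    · exact IsPrimitiveRoot.orderOf η
    · rw [hη1]
      intro h
      exact h2' (by linear_combination -h)
    · rw [pow_succ, pow_mul, hη1, neg_one_sq]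
  obtain ⟨m, -, hm⟩ := hη2.eq_pow_of_pow_eq_one hε.pow_eq_one
  have hdvd : g ∣ (minpoly k ε).comp (X ^ m) := by
    have h1 : minpoly k η ∣ (minpoly k ε).comp (X ^ m) := minpoly.dvd _ _ (by
      rw [aeval_comp, map_pow, aeval_X, hm, minpoly.aeval])
    rw [← minpoly.eq_of_irreducible hg hη] at h1
    exact (dvd_mul_right _ _).trans h1
  have hkill : ∀ p : k[X], g ∣ p → aeval A.1 p w = 0 := by
    rintro _ ⟨p, rfl⟩
    rw [mul_comm, map_mul, End.mul_apply, hgw, map_zero]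
  refine ⟨A ^ m, B, w, by rw [← conj_pow, hBA, inv_pow], hw, ?_, ?_⟩
  · rw [← End.mul_apply, ← Units.val_mul, hBB, eq_neg_iff_add_eq_zero]
    simpa using hkill _ hgp
  · have := hkill _ hdvd
    rwa [aeval_comp, map_pow, aeval_X] at this

theorem LinearMap.prodMap_pow {W : Type*} [AddCommGroup W] [Module k W]
    (f : End k V) (h : End k W) (n : ℕ) : f.prodMap h ^ n = (f ^ n).prodMap (h ^ n) := by
  induction n with
  | zero => exact LinearMap.prodMap_one.symm
  | succ n ih => rw [pow_succ, ih, LinearMap.prodMap_mul, ← pow_succ, ← pow_succ]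

variable {K : Type*} [Field K] [Algebra k K]

theorem aeval_apply_of_intertwine {T : K →ₗ[k] V} {Z : End k V} {z : K}
    (h : ∀ c, Z (T c) = T (z * c)) (p : k[X]) (c : K) : aeval Z p (T c) = T (aeval z p * c) := by
  induction p using Polynomial.induction_on' with
  | add p q hp hq => rw [map_add, LinearMap.add_apply, hp, hq, map_add, add_mul, map_add]
  | monomial n r =>
    rw [aeval_monomial, aeval_monomial, mul_assoc, ← Algebra.smul_def, ← Algebra.smul_def,
      map_smul, LinearMap.smul_apply]
    congr 1
    induction n generalizing c with
    | zero => simp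
    | succ n ih => rw [pow_succ, End.mul_apply, h, ih, pow_succ, mul_assoc]

namespace PowerBasis

/-- A vector killed by the minimal polynomial of a generator generates a quotient of the field. -/
theorem exists_intertwine (pb : PowerBasis k K) {Z : End k V} {w : V}
    (h : aeval Z (minpoly k pb.gen) w = 0) :
    ∃ T : K →ₗ[k] V, T 1 = w ∧ ∀ c, Z (T c) = T (pb.gen * c) := by
  have hs : Function.Surjective (aeval pb.gen : k[X] →ₐ[k] K).toLinearMap := fun c => by
    obtain ⟨p, hp⟩ := pb.exists_eq_aeval' c
    exact ⟨p, hp.symm⟩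
  obtain ⟨r, hr⟩ := LinearMap.exists_rightInverse_of_surjective _ (LinearMap.range_eq_top.2 hs)
  have hr' : ∀ c, aeval pb.gen (r c) = c := fun c => LinearMap.congr_fun hr c
  let E : k[X] →ₗ[k] V := (LinearMap.applyₗ w) ∘ₗ (aeval Z : k[X] →ₐ[k] End k V).toLinearMap
  have hE : ∀ p, E p = aeval Z p w := fun p => rfl
  have key : ∀ p, E (r (aeval pb.gen p)) = aeval Z p w := fun p => by
    obtain ⟨q, hq⟩ := minpoly.dvd k pb.gen (p := r (aeval pb.gen p) - p) (by
      rw [map_sub, hr', sub_self])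
    rw [← hE, ← sub_eq_zero, ← map_sub, hq, hE, mul_comm, map_mul, End.mul_apply, h, map_zero]
  refine ⟨E ∘ₗ r, ?_, fun c => ?_⟩
  · simpa using key 1
  · obtain ⟨p, rfl⟩ := hs c
    have := key (X * p)
    rw [map_mul (aeval pb.gen), aeval_X, map_mul (aeval Z), aeval_X, End.mul_apply] at this
    change Z (E (r (aeval pb.gen p))) = E (r (pb.gen * aeval pb.gen p))
    rw [this, key]

theorem intertwine_injective (pb : PowerBasis k K) {Z : End k V} {T : K →ₗ[k] V}
    (hT : ∀ c, Z (T c) = T (pb.gen * c)) (h1 : T 1 ≠ 0) : Function.Injective T := by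
  rw [injective_iff_map_eq_zero]
  intro c hc
  by_contra h0
  obtain ⟨p, hp⟩ := pb.exists_eq_aeval' c⁻¹
  have := aeval_apply_of_intertwine hT p c
  rw [← hp, inv_mul_cancel₀ h0, hc, map_zero] at this
  exact h1 this.symm

theorem algEquiv_apply_apply_of_inv (pb : PowerBasis k K) {σ : K ≃ₐ[k] K}
    (hσ : σ pb.gen = pb.gen⁻¹) (c : K) : σ (σ c) = c := by
  have : σ.toAlgHom.comp σ.toAlgHom = AlgHom.id k K := pb.algHom_ext (by
    change σ (σ pb.gen) = pb.gen
    rw [hσ, map_inv₀, hσ, inv_inv])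
  exact DFunLike.congr_fun this c

/-- Either the field and its translate span a space of twice the dimension, or there is an
automorphism inverting the generator for which `-1` is a norm. -/
theorem finrank_le_or_exists_norm [FiniteDimensional k V] (pb : PowerBasis k K) (hg : pb.gen ≠ 0)
    {x y : (End k V)ˣ} {w : V} (hxy : y * x * y⁻¹ = x⁻¹) (hw : w ≠ 0) (hyy : y.1 (y.1 w) = -w)
    (hf : aeval x.1 (minpoly k pb.gen) w = 0) :
    Module.finrank k K ≤ Module.finrank k V ∧ (2 * Module.finrank k K ≤ Module.finrank k V ∨
      ∃ σ : K ≃ₐ[k] K, σ pb.gen = pb.gen⁻¹ ∧ ∃ b, σ b * b = -1) := by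
  have := pb.finite
  obtain ⟨T, hT1, hT⟩ := pb.exists_intertwine hf
  have hTi : Function.Injective T := pb.intertwine_injective hT (hT1 ▸ hw)
  refine ⟨LinearMap.finrank_le_finrank_of_injective hTi, ?_⟩
  by_cases hinj : Function.Injective (T.coprod (y.1 ∘ₗ T))
  · left
    have := LinearMap.finrank_le_finrank_of_injective hinj
    rwa [finrank_prod, ← two_mul] at this
  right
  have hyi : ∀ v, y.1 v = 0 → v = 0 := fun v hv => by
    have : (y⁻¹.1 * y.1) v = 0 := by rw [End.mul_apply, hv, map_zero]
    rwa [Units.inv_mul] at this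
  have hyx : ∀ v, y.1 (x.1 v) = x⁻¹.1 (y.1 v) := fun v => by
    rw [← End.mul_apply, ← End.mul_apply, ← Units.val_mul, ← Units.val_mul,
      mul_inv_eq_iff_eq_mul.1 hxy]
  have hxx : ∀ v, x⁻¹.1 (x.1 v) = v := fun v => by
    rw [← End.mul_apply, Units.inv_mul, End.one_apply]
  have hxx' : ∀ v, x.1 (x⁻¹.1 v) = v := fun v => by
    rw [← End.mul_apply, Units.mul_inv, End.one_apply]
  have hyx' : ∀ v, x.1 (y.1 v) = y.1 (x⁻¹.1 v) := fun v => by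
    rw [← hxx' v, hyx, hxx', hxx']
  have hT' : ∀ c, x⁻¹.1 (T c) = T (pb.gen⁻¹ * c) := fun c => by
    rw [← hxx (T (pb.gen⁻¹ * c)), hT, mul_inv_cancel_left₀ hg]
  rw [injective_iff_map_eq_zero] at hinj
  push Not at hinj
  obtain ⟨⟨c, d⟩, hcd, hne⟩ := hinj
  replace hcd : T c + y.1 (T d) = 0 := hcd
  have hd : d ≠ 0 := by
    rintro rfl
    rw [map_zero, map_zero, add_zero] at hcd
    exact hne (by rw [(injective_iff_map_eq_zero T).1 hTi c hcd]; rfl)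
  have hc : c ≠ 0 := by
    rintro rfl
    rw [map_zero, zero_add] at hcd
    exact hd ((injective_iff_map_eq_zero T).1 hTi d (hyi _ hcd))
  have hroot : aeval pb.gen⁻¹ (minpoly k pb.gen) = 0 := by
    have hy : ∀ c, x⁻¹.1 ((y.1 ∘ₗ T) c) = (y.1 ∘ₗ T) (pb.gen * c) := fun c => by
      rw [LinearMap.comp_apply, ← hyx, hT]; rfl
    have h1 := aeval_apply_of_intertwine hT' (minpoly k pb.gen) c
    have h2 := aeval_apply_of_intertwine hy (minpoly k pb.gen) d
    rw [minpoly.aeval, zero_mul, map_zero, LinearMap.comp_apply] at h2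
    rw [eq_neg_of_add_eq_zero_left hcd, map_neg, h2, neg_zero] at h1
    exact (mul_eq_zero.1 ((injective_iff_map_eq_zero T).1 hTi _ h1.symm)).resolve_right hc
  let σ : K ≃ₐ[k] K := AlgEquiv.ofBijective (pb.lift pb.gen⁻¹ hroot) (AlgHom.bijective _)
  have hσ : σ pb.gen = pb.gen⁻¹ := pb.lift_gen _ hroot
  have hσσ := pb.algEquiv_apply_apply_of_inv hσ
  refine ⟨σ, hσ, ?_⟩
  let S : K →ₗ[k] V := y.1 ∘ₗ T ∘ₗ σ.toLinearMap
  have hS' : ∀ c, S c = y.1 (T (σ c)) := fun c => rfl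
  have hS : ∀ c, x.1 (S c) = S (pb.gen * c) := fun c => by
    rw [hS', hS', map_mul, hσ, hyx', hT']
  set e := σ d with he
  have he0 : e ≠ 0 := by rw [he]; exact (map_ne_zero σ).2 hd
  have hSe : S e = - T c := by
    rw [hS', he, hσσ]; exact eq_neg_of_add_eq_zero_right hcd
  have mulS : ∀ z c, ∃ p : k[X], aeval x.1 p (S c) = S (z * c) ∧
      ∀ c', aeval x.1 p (T c') = T (z * c') := fun z c => by
    obtain ⟨p, hp⟩ := pb.exists_eq_aeval' z
    exact ⟨p, by rw [aeval_apply_of_intertwine hS, ← hp],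
      fun c' => by rw [aeval_apply_of_intertwine hT, ← hp]⟩
  obtain ⟨b, hb⟩ : ∃ b, S 1 = T b := by
    obtain ⟨p, hp, hp'⟩ := mulS e⁻¹ e
    refine ⟨-(e⁻¹ * c), ?_⟩
    rw [inv_mul_cancel₀ he0, hSe, map_neg, hp'] at hp
    rw [← hp, map_neg]
  refine ⟨b, hTi ?_⟩
  obtain ⟨p, hp, hp'⟩ := mulS (σ b) 1
  rw [mul_one, hb, hp', hS', hσσ, ← hb, hS', map_one, hT1, hyy] at hp
  rw [hp, map_neg, hT1]

end PowerBasis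

theorem minFaithfulDim_quaternionGroup {t : ℕ} (h2 : (2 : k) ≠ 0)
    {ε : AlgebraicClosure k} (hε : IsPrimitiveRoot ε (2 ^ (t + 1))) :
    ((∃ σ : k⟮ε⟯ ≃ₐ[k] k⟮ε⟯, σ (AdjoinSimple.gen k ε) = (AdjoinSimple.gen k ε)⁻¹ ∧
      ∃ b, σ b * b = -1) →
        minFaithfulDim k (QuaternionGroup (2 ^ t)) = Module.finrank k k⟮ε⟯) ∧
    ((¬ ∃ σ : k⟮ε⟯ ≃ₐ[k] k⟮ε⟯, σ (AdjoinSimple.gen k ε) = (AdjoinSimple.gen k ε)⁻¹ ∧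
      ∃ b, σ b * b = -1) →
        minFaithfulDim k (QuaternionGroup (2 ^ t)) = 2 * Module.finrank k k⟮ε⟯) := by
  have hint : IsIntegral k ε := Algebra.IsIntegral.isIntegral ε
  set g := AdjoinSimple.gen k ε with hg
  let pb := adjoin.powerBasis hint
  have hpb : pb.gen = g := adjoin.powerBasis_gen hint
  have := pb.finite
  have hgε : (g : AlgebraicClosure k) = ε := AdjoinSimple.coe_gen k ε
  have hgp : IsPrimitiveRoot g (2 ^ (t + 1)) := IsPrimitiveRoot.coe_submonoidClass_iff.1 (by
    rwa [hgε])
  have hg0 : g ≠ 0 := hgp.ne_zero (by positivity)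
  have hgt : g ^ 2 ^ t = -1 := by
    have h : IsPrimitiveRoot (g ^ 2 ^ t) 2 := hgp.pow (by positivity) (pow_succ 2 t)
    exact h.eq_neg_one_of_two_right
  have hmp : minpoly k pb.gen = minpoly k ε := by rw [hpb]; exact minpoly_gen k ε
  have lower : ∀ d, (∃ φ : QuaternionGroup (2 ^ t) →* Matrix.GeneralLinearGroup (Fin d) k,
      Function.Injective φ) → Module.finrank k k⟮ε⟯ ≤ d ∧ (2 * Module.finrank k k⟮ε⟯ ≤ d ∨
      ∃ σ : k⟮ε⟯ ≃ₐ[k] k⟮ε⟯, σ g = g⁻¹ ∧ ∃ b, σ b * b = -1) := by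
    rintro d ⟨φ, hφ⟩
    obtain ⟨x, y, w, hxy, hw, hyy, hf⟩ := QuaternionGroup.exists_units_of_faithful h2 hε
      (ψ := (Matrix.GeneralLinearGroup.toLin (n := Fin d) (R := k)).toMonoidHom.comp φ)
      (Matrix.GeneralLinearGroup.toLin.injective.comp hφ)
    have := pb.finrank_le_or_exists_norm (by rwa [hpb]) hxy hw hyy (by rwa [hmp])
    rwa [hpb, Module.finrank_fin_fun] at this
  have hneg : ∀ {W : Type _} [AddCommGroup W] [Module k W] [Nontrivial W],
      (-1 : Module.End k W) ≠ 1 := by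
    intro W _ _ _ h
    obtain ⟨v, hv⟩ := exists_ne (0 : W)
    have h1 : -v = v := LinearMap.congr_fun h v
    refine hv ((smul_eq_zero.1 (?_ : (2 : k) • v = 0)).resolve_left h2)
    rw [two_smul]
    nth_rewrite 1 [← h1]
    exact neg_add_cancel v
  constructor
  · rintro ⟨σ, hσ, b, hb⟩
    have hmem := QuaternionGroup.exists_faithful_of_end (k := k) (V := k⟮ε⟯) (t := t)
      (A := LinearMap.mulLeft k g) (A' := LinearMap.mulLeft k g⁻¹)
      (B := LinearMap.mulLeft k b ∘ₗ σ.toLinearMap)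
      (by ext c; simp [hg0]) (by ext c; simp [hg0])
      (by
        rw [LinearMap.pow_mulLeft, hgt]
        ext c; simp)
      (by
        refine LinearMap.ext fun c => ?_
        have hσσ := pb.algEquiv_apply_apply_of_inv (by rwa [hpb]) c
        change b * σ (b * σ c) = -c
        rw [map_mul, hσσ]
        linear_combination c * hb)
      (by
        refine LinearMap.ext fun c => ?_
        change b * σ (g * c) = g⁻¹ * (b * σ c)
        rw [map_mul, hσ]; ring)
      hneg
    exact le_antisymm (Nat.sInf_le hmem) (le_csInf ⟨_, hmem⟩ fun d hd => (lower d hd).1)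
  · intro hno
    have hmem := QuaternionGroup.exists_faithful_of_end (k := k) (V := k⟮ε⟯ × k⟮ε⟯) (t := t)
      (A := (LinearMap.mulLeft k g).prodMap (LinearMap.mulLeft k g⁻¹))
      (A' := (LinearMap.mulLeft k g⁻¹).prodMap (LinearMap.mulLeft k g))
      (B := (-LinearMap.snd k _ _).prod (LinearMap.fst k _ _))
      (by refine LinearMap.ext fun c => ?_; ext <;> simp [hg0])
      (by refine LinearMap.ext fun c => ?_; ext <;> simp [hg0])
      (by
        rw [LinearMap.prodMap_pow, LinearMap.pow_mulLeft, LinearMap.pow_mulLeft, inv_pow, hgt]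
        refine LinearMap.ext fun c => ?_
        ext <;> simp)
      (by refine LinearMap.ext fun c => ?_; ext <;> simp)
      (by refine LinearMap.ext fun c => ?_; ext <;> simp)
      hneg
    rw [Module.finrank_prod, ← two_mul] at hmem
    exact le_antisymm (Nat.sInf_le hmem)
      (le_csInf ⟨_, hmem⟩ fun d hd => (lower d hd).2.resolve_right hno)

/-- When `ε ↦ ε⁻¹` is an automorphism, `-1` is a norm from `k(ε)` to `k(ε + ε⁻¹)` if and only if it
is a sum of two squares in `k(ε + ε⁻¹)`. -/
theorem exists_norm_eq_neg_one_iff {t : ℕ} (ht : 1 ≤ t) (h2 : (2 : k) ≠ 0)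
    {ε : AlgebraicClosure k} (hε : IsPrimitiveRoot ε (2 ^ (t + 1)))
    {σ : k⟮ε⟯ ≃ₐ[k] k⟮ε⟯} (hσ : σ (AdjoinSimple.gen k ε) = (AdjoinSimple.gen k ε)⁻¹) :
    (∃ b, σ b * b = -1) ↔ ∃ x y : k⟮ε + ε⁻¹⟯, x ^ 2 + y ^ 2 = -1 := by
  set g := AdjoinSimple.gen k ε with hg
  have hint : IsIntegral k ε := Algebra.IsIntegral.isIntegral ε
  let pb := adjoin.powerBasis hint
  have hpb : pb.gen = g := adjoin.powerBasis_gen hint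
  have h2' : (2 : k⟮ε⟯) ≠ 0 := by
    have := (map_ne_zero (algebraMap k k⟮ε⟯)).2 h2
    rwa [map_ofNat] at this
  have hgε : (g : AlgebraicClosure k) = ε := AdjoinSimple.coe_gen k ε
  have hgp : IsPrimitiveRoot g (2 ^ (t + 1)) := IsPrimitiveRoot.coe_submonoidClass_iff.1 (by
    rwa [hgε])
  have hg0 : g ≠ 0 := hgp.ne_zero (by positivity)
  have hgg : g - g⁻¹ ≠ 0 := fun h => by
    have h1 : g ^ 2 = 1 := by
      field_simp at h
      linear_combination h
    have h3 := Nat.le_of_dvd two_pos (hgp.dvd_of_pow_eq_one 2 h1)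
    have : 2 ^ 2 ≤ 2 ^ (t + 1) := Nat.pow_le_pow_right two_pos (by omega)
    omega
  obtain ⟨i, hi, hσi⟩ : ∃ i : k⟮ε⟯, i ^ 2 = -1 ∧ σ i = -i := by
    obtain ⟨u, rfl⟩ : ∃ u, t = u + 1 := ⟨t - 1, by omega⟩
    have h : IsPrimitiveRoot (g ^ 2 ^ (u + 1)) 2 := hgp.pow (by positivity) (pow_succ 2 _)
    have hi : (g ^ 2 ^ u) ^ 2 = -1 := by rw [← pow_mul, ← pow_succ]; exact h.eq_neg_one_of_two_right
    refine ⟨g ^ 2 ^ u, hi, ?_⟩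
    rw [map_pow, hσ, inv_pow]
    refine inv_eq_of_mul_eq_one_right ?_
    linear_combination -hi
  let K₀ : Subfield k⟮ε⟯ := k⟮ε + ε⁻¹⟯.toSubfield.comap (k⟮ε⟯.val : k⟮ε⟯ →+* AlgebraicClosure k)
  have hK₀ : ∀ c : k⟮ε⟯, c ∈ K₀ ↔ (c : AlgebraicClosure k) ∈ k⟮ε + ε⁻¹⟯ := fun c => Iff.rfl
  have hle : ∀ c ∈ k⟮ε + ε⁻¹⟯, ∃ h : c ∈ k⟮ε⟯, σ ⟨c, h⟩ = ⟨c, h⟩ := by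
    intro c hc
    induction hc using adjoin_induction with
    | mem x hx =>
      obtain rfl := hx
      have hmem : ε ∈ k⟮ε⟯ := mem_adjoin_simple_self k ε
      refine ⟨add_mem hmem (inv_mem hmem), ?_⟩
      change σ (g + g⁻¹) = g + g⁻¹
      rw [map_add, map_inv₀, hσ, inv_inv, add_comm]
    | algebraMap r => exact ⟨_root_.algebraMap_mem _ r, σ.commutes r⟩
    | add x y _ _ hx hy =>
      obtain ⟨hx, hx'⟩ := hx
      obtain ⟨hy, hy'⟩ := hy
      refine ⟨add_mem hx hy, ?_⟩
      change σ (⟨x, hx⟩ + ⟨y, hy⟩) = ⟨x, hx⟩ + ⟨y, hy⟩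
      rw [map_add, hx', hy']
    | inv x _ hx =>
      obtain ⟨hx, hx'⟩ := hx
      refine ⟨inv_mem hx, ?_⟩
      change σ (⟨x, hx⟩⁻¹) = ⟨x, hx⟩⁻¹
      rw [map_inv₀, hx']
    | mul x y _ _ hx hy =>
      obtain ⟨hx, hx'⟩ := hx
      obtain ⟨hy, hy'⟩ := hy
      refine ⟨mul_mem hx hy, ?_⟩
      change σ (⟨x, hx⟩ * ⟨y, hy⟩) = ⟨x, hx⟩ * ⟨y, hy⟩
      rw [map_mul, hx', hy']
  have hfix : ∀ c ∈ K₀, σ c = c := fun c hc => (hle c hc).2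
  have htr : g + g⁻¹ ∈ K₀ := (hK₀ _).2 (by
    push_cast
    rw [hgε]
    exact mem_adjoin_simple_self k _)
  have hdec : ∀ c : k⟮ε⟯, ∃ u ∈ K₀, ∃ v ∈ K₀, c = u + v * g := by
    intro c
    obtain ⟨p, rfl⟩ := pb.exists_eq_aeval' c
    rw [hpb]
    have halg : ∀ r : k, algebraMap k k⟮ε⟯ r ∈ K₀ := fun r => (hK₀ _).2 (_root_.algebraMap_mem _ r)
    induction p using Polynomial.induction_on with
    | C r => exact ⟨algebraMap k _ r, halg r, 0, zero_mem _, by simp⟩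
    | add p q hp hq =>
      obtain ⟨u, hu, v, hv, h⟩ := hp
      obtain ⟨u', hu', v', hv', h'⟩ := hq
      exact ⟨u + u', add_mem hu hu', v + v', add_mem hv hv', by rw [map_add, h, h']; ring⟩
    | monomial n r h =>
      obtain ⟨u, hu, v, hv, h⟩ := h
      refine ⟨-v, neg_mem hv, u + v * (g + g⁻¹), add_mem hu (mul_mem hv htr), ?_⟩
      rw [pow_succ, ← mul_assoc, map_mul, h, aeval_X]
      field_simp
      ring
  have hmem : ∀ c, σ c = c → c ∈ K₀ := fun c hc => by
    obtain ⟨u, hu, v, hv, rfl⟩ := hdec c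
    rw [map_add, map_mul, hσ, hfix u hu, hfix v hv] at hc
    have : v * (g - g⁻¹) = 0 := by linear_combination -hc
    rw [(mul_eq_zero.1 this).resolve_right hgg, zero_mul, add_zero]
    exact hu
  have hσσ := pb.algEquiv_apply_apply_of_inv (by rwa [hpb])
  constructor
  · rintro ⟨b, hb⟩
    have hx : (b + σ b) / 2 ∈ K₀ := hmem _ (by
      rw [map_div₀, map_add, hσσ, map_ofNat, add_comm])
    have hy : -i * (b - σ b) / 2 ∈ K₀ := hmem _ (by
      rw [map_div₀, map_mul, map_sub, map_neg, hσi, hσσ, map_ofNat]; ring)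
    refine ⟨⟨_, hx⟩, ⟨_, hy⟩, Subtype.ext ?_⟩
    have : ((b + σ b) / 2) ^ 2 + (-i * (b - σ b) / 2) ^ 2 = -1 := by
      field_simp
      linear_combination (b - σ b) ^ 2 * hi + 4 * hb
    have h := congrArg Subtype.val this
    exact h
  · rintro ⟨⟨x, hx⟩, ⟨y, hy⟩, hxy⟩
    have hxy' : x ^ 2 + y ^ 2 = -1 := congrArg Subtype.val hxy
    obtain ⟨hx, hx'⟩ := hle x hx
    obtain ⟨hy, hy'⟩ := hle y hy
    refine ⟨⟨x, hx⟩ + i * ⟨y, hy⟩, ?_⟩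
    have h : (⟨x, hx⟩ : k⟮ε⟯) ^ 2 + (⟨y, hy⟩ : k⟮ε⟯) ^ 2 = -1 :=
      Subtype.ext hxy'
    rw [map_add, map_mul, hσi, hx', hy']
    linear_combination h - (⟨y, hy⟩ : k⟮ε⟯) ^ 2 * hi

end

theorem stmt5 (p r q s : ℕ) (hp : p.Prime) (hodd : p ≠ 2) (hr : 1 ≤ r)
    (hq : q = p ^ r) (hq4 : q % 4 = 1) (hs : s = padicValNat 2 (q - 1))
    (k : Type*) [Field k] (hchar : ringChar k ≠ 2)
    (ε : AlgebraicClosure k) (hε : IsPrimitiveRoot ε (2 ^ s))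
    (F : Type*) [Field F] [Fintype F] (hF : Fintype.card F = q)
    (P : Sylow 2 (Matrix.SpecialLinearGroup (Fin 2) F)) :
    (¬ (∃ σ : k⟮ε⟯ ≃ₐ[k] k⟮ε⟯, σ (AdjoinSimple.gen k ε) = (AdjoinSimple.gen k ε)⁻¹) →
      minFaithfulDim k ↥P = 2 * Module.finrank k (IntermediateField.adjoin k {ε})) ∧
    ((∃ σ : k⟮ε⟯ ≃ₐ[k] k⟮ε⟯, σ (AdjoinSimple.gen k ε) = (AdjoinSimple.gen k ε)⁻¹) →
      ((∃ x y : (IntermediateField.adjoin k {ε + ε⁻¹} :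
            IntermediateField k (AlgebraicClosure k)), x ^ 2 + y ^ 2 = -1) →
        minFaithfulDim k ↥P = Module.finrank k (IntermediateField.adjoin k {ε})) ∧
      (¬ (∃ x y : (IntermediateField.adjoin k {ε + ε⁻¹} :
            IntermediateField k (AlgebraicClosure k)), x ^ 2 + y ^ 2 = -1) →
        minFaithfulDim k ↥P = 2 * Module.finrank k (IntermediateField.adjoin k {ε}))) := by
  have h2 : (2 : k) ≠ 0 := Ring.two_ne_zero hchar
  have hq1 : 1 < q := hF ▸ Fintype.one_lt_card
  have : Fact (Nat.Prime 2) := ⟨Nat.prime_two⟩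
  obtain ⟨t, ht, rfl⟩ : ∃ t, 1 ≤ t ∧ s = t + 1 := by
    have : 2 ≤ s := by
      rw [hs]
      exact (padicValNat_dvd_iff_le (by omega)).1 (by norm_num; omega)
    exact ⟨s - 1, by omega, by omega⟩
  obtain ⟨e⟩ := nonempty_mulEquiv_quaternionGroup ht (by rw [hF, ← hs]) P
  obtain ⟨hsplit, hnonsplit⟩ := minFaithfulDim_quaternionGroup h2 hε
  rw [← minFaithfulDim_congr k e]
  refine ⟨fun h => hnonsplit fun ⟨σ, hσ, _⟩ => h ⟨σ, hσ⟩, fun ⟨σ, hσ⟩ => ⟨fun h => hsplit ?_,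
    fun h => hnonsplit ?_⟩⟩
  · exact ⟨σ, hσ, (exists_norm_eq_neg_one_iff ht h2 hε hσ).2 h⟩
  · rintro ⟨τ, hτ, hb⟩
    exact h ((exists_norm_eq_neg_one_iff ht h2 hε hτ).1 hb)
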